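/- Let α ∈ (1,2). There exists C > 0, depending only on α, such that for every T > 0, every sequence (λ_n) of positive reals, and all real sequences (a_n), (b_n): ∫_0^T ∑_n λ_n² | a_n E_α(−λ_n t^α) + b_n t E_{α,2}(−λ_n t^α) |² dt ≤ C T^{1−α/2} ∑_n λ_n^{3/2} a_n² + C T^{3−(3/2)α} ∑_n λ_n^{1/2} b_n². (This is the estimate ‖∂_t^α u‖²_{L²(0,T;L²(Ω))} ≤ C T^{1−α/2}‖∇Δu_0‖² + C T^{3−3α/2}‖∇u_1‖² for the solution series of the fractional Petrovsky system.) -/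

import Mathlib

open MeasureTheory

/-- The Mittag-Leffler function `E_{α,β}(x) = ∑_{k=0}^∞ x^k / Γ(αk + β)` for real `x`. -/
noncomputable def mittagLeffler (α β x : ℝ) : ℝ :=
  ∑' k : ℕ, x ^ k / Real.Gamma (α * k + β)

lemma gamma_lower (R y : ℝ) (hR : 0 < R) (hy : 1 ≤ y) :
    R ^ (y - 1) * Real.exp (-R) ≤ Real.Gamma y := by
  have hy0 : 0 < y := by linarith
  rw [Real.Gamma_eq_integral hy0]
  have h1 : ∫ x in Set.Ioi R, Real.exp (-x) * x ^ (y - 1) ≤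
      ∫ x in Set.Ioi (0:ℝ), Real.exp (-x) * x ^ (y - 1) := by
    apply setIntegral_mono_set (Real.GammaIntegral_convergent hy0)
    · filter_upwards [self_mem_ae_restrict measurableSet_Ioi] with x hx
      have : (0:ℝ) < x := hx
      simp only [Pi.zero_apply]
      positivity
    · exact (Set.Ioi_subset_Ioi hR.le).eventuallyLE
  refine le_trans ?_ h1
  have h2 : ∫ x in Set.Ioi R, Real.exp (-x) * R ^ (y - 1) = R ^ (y - 1) * Real.exp (-R) := by
    rw [integral_mul_const, integral_exp_neg_Ioi, mul_comm]
  rw [← h2]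
  apply setIntegral_mono_on
  · exact (integrableOn_exp_neg_Ioi R).mul_const _
  · exact (Real.GammaIntegral_convergent hy0).mono_set (Set.Ioi_subset_Ioi hR.le)
  · exact measurableSet_Ioi
  · intro x hx
    have hx' : R < x := hx
    gcongr

lemma ml_summable (α β x : ℝ) (hα : 0 < α) (hβ : 1 ≤ β) :
    Summable fun k : ℕ => |x| ^ k / Real.Gamma (α * k + β) := by
  set R : ℝ := (2 * |x| + 1) ^ (1 / α) with hR
  have hR0 : 0 < R := by positivity
  have hRα : R ^ α = 2 * |x| + 1 := by
    rw [hR, ← Real.rpow_mul (by positivity)]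
    field_simp
    simp
  have hlt : |x| / (2 * |x| + 1) < 1 := by
    rw [div_lt_one (by positivity)]
    linarith [abs_nonneg x]
  have hg := (summable_geometric_of_lt_one (by positivity) hlt).mul_left
    (Real.exp R * R ^ (1 - β))
  refine Summable.of_nonneg_of_le ?_ ?_ hg
  · intro k
    have : 0 < Real.Gamma (α * k + β) := Real.Gamma_pos_of_pos (by positivity)
    positivity
  · intro k
    have hk : 1 ≤ α * k + β := by nlinarith [mul_nonneg hα.le (Nat.cast_nonneg (α := ℝ) k)]
    have h := gamma_lower R (α * k + β) hR0 hk
    have h1 : R ^ (α * k + β - 1) = (2 * |x| + 1) ^ k * R ^ (β - 1) := by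
      rw [← hRα, ← Real.rpow_natCast, ← Real.rpow_mul hR0.le, ← Real.rpow_add hR0]
      congr 1; ring
    have h2 : R ^ (1 - β) * R ^ (β - 1) = 1 := by
      rw [← Real.rpow_add hR0]; simp
    have h3 : Real.exp R * Real.exp (-R) = 1 := by
      rw [← Real.exp_add]; simp
    rw [h1] at h
    have hG : 0 < Real.Gamma (α * k + β) := Real.Gamma_pos_of_pos (by linarith)
    rw [div_le_iff₀ hG, div_pow]
    calc |x| ^ k = (Real.exp R * Real.exp (-R)) * (R ^ (1 - β) * R ^ (β - 1)) * |x| ^ k := by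
          rw [h2, h3]; ring
      _ = Real.exp R * R ^ (1 - β) * (|x| ^ k / (2 * |x| + 1) ^ k) *
          ((2 * |x| + 1) ^ k * R ^ (β - 1) * Real.exp (-R)) := by
          field_simp
      _ ≤ _ := by gcongr

lemma laplace_int (p : ℝ) (hp : 0 < p) (ε : ℝ) (hε : 0 < ε) :
    IntegrableOn (fun t : ℝ => t ^ (p - 1) * Real.exp (-(ε * t))) (Set.Ioi 0) := by
  have := integrableOn_rpow_mul_exp_neg_mul_rpow (s := p - 1) (p := 1) (b := ε) (by linarith) zero_lt_one hε
  simpa using this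

lemma laplace_gamma (p : ℝ) (hp : 0 < p) (r : ℂ) (hr : 0 < r.re) :
    ∫ t in Set.Ioi (0:ℝ), ((t ^ (p - 1) : ℝ) : ℂ) * Complex.exp (-(r * t)) =
      r ^ (-(p : ℂ)) * Real.Gamma p := by
  set U : Set ℂ := {z | 0 < z.re} with hU
  have hUo : IsOpen U := isOpen_lt continuous_const Complex.continuous_re
  have hUc : IsPreconnected U := (convex_halfSpace_re_gt 0).isPreconnected
  have hf : DifferentiableOn ℂ (fun z : ℂ => ∫ t in Set.Ioi (0:ℝ), ((t ^ (p - 1) : ℝ) : ℂ) *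
      Complex.exp (-(z * t))) U := by
    intro z hz
    have hz' : 0 < z.re := hz
    apply DifferentiableAt.differentiableWithinAt
    have := hasDerivAt_integral_of_dominated_loc_of_deriv_le (μ := volume.restrict (Set.Ioi (0:ℝ)))
      (F := fun (z : ℂ) (t : ℝ) => ((t ^ (p - 1) : ℝ) : ℂ) * Complex.exp (-(z * t)))
      (F' := fun (z : ℂ) (t : ℝ) => ((t ^ (p - 1) : ℝ) : ℂ) * (Complex.exp (-(z * t)) * (-t)))
      (x₀ := z) (s := {w : ℂ | z.re / 2 < w.re})
      (bound := fun t => t ^ ((p + 1) - 1) * Real.exp (-(z.re / 2 * t)))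
      ((isOpen_lt continuous_const Complex.continuous_re).mem_nhds (by simp; linarith)) ?_ ?_ ?_ ?_ ?_ ?_
    · exact this.2.differentiableAt
    · refine Filter.Eventually.of_forall fun w => ?_
      apply Measurable.aestronglyMeasurable
      fun_prop
    · refine (laplace_int p hp z.re hz').mono' ?_ ?_
      · apply Measurable.aestronglyMeasurable
        fun_prop
      · filter_upwards [self_mem_ae_restrict measurableSet_Ioi] with t ht
        have ht : (0:ℝ) < t := ht
        rw [norm_mul, Complex.norm_real, Complex.norm_exp, Real.norm_of_nonneg (by positivity)]
        simp
    · apply Measurable.aestronglyMeasurable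
      fun_prop
    · filter_upwards [self_mem_ae_restrict measurableSet_Ioi] with t ht w hw
      have ht : (0:ℝ) < t := ht
      have hw : z.re / 2 < w.re := hw
      rw [norm_mul, norm_mul, norm_neg, Complex.norm_real, Complex.norm_real, Complex.norm_exp,
        Real.norm_of_nonneg (by positivity), Real.norm_of_nonneg (by positivity)]
      have : t ^ (p + 1 - 1) = t ^ (p - 1) * t := by
        rw [← Real.rpow_add_one ht.ne']; ring_nf
      rw [this, mul_assoc, mul_comm t]
      have : (-(w * (t:ℂ))).re ≤ -(z.re / 2 * t) := by
        simp; nlinarith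
      gcongr
    · exact laplace_int (p + 1) (by linarith) (z.re / 2) (by linarith)
    · refine Filter.Eventually.of_forall fun t w _ => ?_
      apply HasDerivAt.const_mul
      have : HasDerivAt (fun w : ℂ => -(w * (t:ℂ))) (-t) w := by
        simpa using ((hasDerivAt_id w).mul_const (t:ℂ)).fun_neg
      exact this.cexp
  have hg : DifferentiableOn ℂ (fun z : ℂ => z ^ (-(p : ℂ)) * Real.Gamma p) U := by
    intro z hz
    apply DifferentiableAt.differentiableWithinAt
    exact (differentiableAt_id.cpow_const (Or.inl hz)).mul_const _
  have key := AnalyticOnNhd.eqOn_of_preconnected_of_frequently_eq (z₀ := 1) (hf.analyticOnNhd hUo)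
    (hg.analyticOnNhd hUo) hUc (by simp [hU]) ?_
  · exact key hr
  have hreal : ∀ x : ℝ, 0 < x → (∫ t in Set.Ioi (0:ℝ), ((t ^ (p - 1) : ℝ) : ℂ) *
      Complex.exp (-((x:ℂ) * t))) = (x:ℂ) ^ (-(p : ℂ)) * Real.Gamma p := by
    intro x hx
    have h := Real.integral_rpow_mul_exp_neg_mul_Ioi hp hx
    have h' := congrArg (fun y : ℝ => (y : ℂ)) h
    simp only [← integral_complex_ofReal] at h'
    rw [show (fun t : ℝ => ((t ^ (p - 1) : ℝ) : ℂ) * Complex.exp (-((x:ℂ) * t))) =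
      fun t : ℝ => ((t ^ (p - 1) * Real.exp (-(x * t)) : ℝ) : ℂ) by ext t; push_cast; rfl, h']
    rw [← Complex.ofReal_neg, ← Complex.ofReal_cpow hx.le, Real.rpow_neg hx.le, one_div,
      Real.inv_rpow hx.le]
    push_cast; rfl
  have htend : Filter.Tendsto (fun n : ℕ => (((1 + 1 / ((n:ℝ) + 1) : ℝ)) : ℂ)) Filter.atTop
      (nhdsWithin 1 {1}ᶜ) := by
    apply tendsto_nhdsWithin_of_tendsto_nhds_of_eventually_within
    · have : Filter.Tendsto (fun n : ℕ => ((1 + 1 / ((n:ℝ) + 1) : ℝ))) Filter.atTop (nhds (1 + 0)) :=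
        tendsto_const_nhds.add tendsto_one_div_add_atTop_nhds_zero_nat
      have := (Complex.continuous_ofReal.tendsto _).comp this
      simpa [Function.comp_def] using this
    · refine Filter.Eventually.of_forall fun n => ?_
      simp only [Set.mem_compl_iff, Set.mem_singleton_iff]
      norm_cast
      have : (0:ℝ) < 1 / ((n:ℝ) + 1) := by positivity
      push_cast
      linarith
  exact htend.frequently (Filter.Eventually.of_forall fun n => hreal _ (by positivity)).frequently

noncomputable def sv (ε ω : ℝ) : ℂ := ε + 2 * Real.pi * ω * Complex.I

lemma sv_re (ε ω : ℝ) : (sv ε ω).re = ε := by simp [sv]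

lemma sv_norm_ge (ε ω : ℝ) (hε : 0 < ε) : ε ≤ ‖sv ε ω‖ := by
  have := Complex.abs_re_le_norm (sv ε ω)
  rwa [sv_re, abs_of_pos hε] at this

lemma sv_continuous (ε : ℝ) : Continuous (sv ε) := by
  unfold sv; fun_prop

lemma sv_ne (ε ω : ℝ) (hε : 0 < ε) : sv ε ω ≠ 0 := by
  intro h
  have := sv_norm_ge ε ω hε
  rw [h, norm_zero] at this
  linarith

lemma sv_cpow_continuous (ε : ℝ) (hε : 0 < ε) (p : ℂ) : Continuous fun ω => sv ε ω ^ p := by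
  refine (sv_continuous ε).cpow continuous_const fun ω => Or.inl ?_
  rw [sv_re]; exact hε

lemma norm_cpow_ofReal (s : ℂ) (hs : 0 < s.re) (p : ℝ) : ‖s ^ (p : ℂ)‖ = ‖s‖ ^ p := by
  have h0 : s ≠ 0 := by rintro rfl; simp at hs
  rw [Complex.norm_cpow_of_ne_zero h0]
  simp

open FourierTransform in
lemma pair_k (ε : ℝ) (hε : 0 < ε) (p : ℝ) (hp : 0 < p) (φ : SchwartzMap ℝ ℂ) :
    ∫ t in Set.Ioi (0:ℝ), ((t ^ (p - 1) / Real.Gamma p * Real.exp (-(ε * t)) : ℝ) : ℂ) * φ t =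
      ∫ ω, sv ε ω ^ (-(p:ℂ)) * (𝓕⁻ φ) ω := by
  set f : ℝ → ℂ := (Set.Ioi (0:ℝ)).indicator
    (fun t => ((t ^ (p - 1) / Real.Gamma p * Real.exp (-(ε * t)) : ℝ) : ℂ)) with hf
  have hG : 0 < Real.Gamma p := Real.Gamma_pos_of_pos hp
  have hint : Integrable f := by
    rw [hf, integrable_indicator_iff measurableSet_Ioi]
    have := ((laplace_int p hp ε hε).div_const (Real.Gamma p)).ofReal (𝕜 := ℂ)
    refine this.congr (Filter.Eventually.of_forall fun t => ?_)
    have h : t ^ (p - 1) * Real.exp (-(ε * t)) / Real.Gamma p =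
      t ^ (p - 1) / Real.Gamma p * Real.exp (-(ε * t)) := by ring
    exact congrArg (fun y : ℝ => (y : ℂ)) h
  have hFf : ∀ ω, 𝓕 f ω = sv ε ω ^ (-(p:ℂ)) := by
    intro ω
    rw [Real.fourier_real_eq_integral_exp_smul]
    have h1 : (fun v : ℝ => Complex.exp (↑(-2 * Real.pi * v * ω) * Complex.I) • f v) =
      (Set.Ioi (0:ℝ)).indicator (fun t => (((t ^ (p - 1) : ℝ) : ℂ) *
        Complex.exp (-(sv ε ω * t))) * (Real.Gamma p : ℂ)⁻¹) := by
      ext v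
      by_cases hv : v ∈ Set.Ioi (0:ℝ)
      · simp only [hf, Set.indicator_of_mem hv, smul_eq_mul]
        have : -(sv ε ω * v) = ((-(ε * v) : ℝ) : ℂ) + ↑(-2 * Real.pi * v * ω) * Complex.I := by
          simp only [sv]; push_cast; ring
        rw [this, Complex.exp_add]
        push_cast
        ring
      · simp only [hf, Set.indicator_of_notMem hv, smul_zero]
    rw [h1, integral_indicator measurableSet_Ioi, integral_mul_const,
      laplace_gamma p hp _ (by rw [sv_re]; exact hε)]
    have : (Real.Gamma p : ℂ) ≠ 0 := by exact_mod_cast hG.ne'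
    field_simp
  have key := VectorFourier.integral_bilin_fourierIntegral_eq_flip (ContinuousLinearMap.mul ℂ ℂ)
    (L := innerₗ ℝ) (μ := volume) (ν := volume) Real.continuous_fourierChar continuous_inner hint
    (𝓕⁻ φ).integrable
  have key2 : ∫ ω, 𝓕 f ω * (𝓕⁻ φ) ω = ∫ x, f x * (𝓕 (𝓕⁻ φ)) x := by
    simp only [ContinuousLinearMap.mul_apply', flip_innerₗ] at key
    exact key
  rw [FourierTransform.fourier_fourierInv_eq] at key2
  simp only [hFf] at key2
  rw [key2, ← integral_indicator measurableSet_Ioi]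
  congr 1
  ext t
  by_cases ht : t ∈ Set.Ioi (0:ℝ)
  · simp [hf, Set.indicator_of_mem ht]
  · simp [hf, Set.indicator_of_notMem ht]

lemma sector_bound (α : ℝ) (h1 : 1 < α) (h2 : α < 2) :
    ∃ c > (0:ℝ), ∀ s : ℂ, 0 < s.re → ∀ x : ℝ, 0 ≤ x → c * (‖s‖ ^ α + x) ≤ ‖s ^ (α:ℂ) + x‖ := by
  set κ := -Real.cos (α * (Real.pi / 2)) with hκ
  have hpi := Real.pi_pos
  have hκ1 : κ < 1 := by
    have : Real.cos Real.pi < Real.cos (α * (Real.pi / 2)) := by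
      apply Real.cos_lt_cos_of_nonneg_of_le_pi <;> nlinarith
    rw [Real.cos_pi] at this
    linarith
  have hκ2 : 0 ≤ κ := by
    have := Real.cos_nonpos_of_pi_div_two_le_of_le (x := α * (Real.pi / 2)) (by nlinarith) (by nlinarith)
    linarith
  refine ⟨Real.sqrt ((1 - κ) / 2), Real.sqrt_pos.2 (by linarith), fun s hs x hx => ?_⟩
  have h0 : s ≠ 0 := by rintro rfl; simp at hs
  set r := ‖s‖ ^ α with hr
  have hr0 : 0 ≤ r := by positivity
  have harg : |s.arg| < Real.pi / 2 := Complex.abs_arg_lt_pi_div_two_iff.2 (Or.inl hs)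
  have hs' : s ^ (α:ℂ) = r * (Real.cos (α * s.arg) + Real.sin (α * s.arg) * Complex.I) := by
    rw [Complex.cpow_def_of_ne_zero h0, Complex.log]
    have : (↑(Real.log ‖s‖) + ↑s.arg * Complex.I) * (α:ℂ) =
      ((Real.log ‖s‖ * α : ℝ) : ℂ) + ((α * s.arg : ℝ) : ℂ) * Complex.I := by push_cast; ring
    rw [this, Complex.exp_add, Complex.exp_mul_I, hr, Real.rpow_def_of_pos (norm_pos_iff.2 h0)]
    push_cast
    rfl
  have hcos : -κ ≤ Real.cos (α * s.arg) := by
    rw [hκ, neg_neg, ← Real.cos_abs (α * s.arg), abs_mul, abs_of_pos (by linarith : 0 < α)]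
    apply Real.cos_le_cos_of_nonneg_of_le_pi
    · positivity
    · nlinarith
    · gcongr
  have hsq : ‖s ^ (α:ℂ) + x‖ ^ 2 = r ^ 2 + x ^ 2 + 2 * r * x * Real.cos (α * s.arg) := by
    rw [hs', ← Complex.normSq_eq_norm_sq, Complex.normSq_apply]
    have := Real.sin_sq_add_cos_sq (α * s.arg)
    simp [-Complex.ofReal_cos, -Complex.ofReal_sin]
    linear_combination r ^ 2 * this
  apply le_of_sq_le_sq _ (norm_nonneg _)
  rw [hsq, mul_pow, Real.sq_sqrt (by linarith)]
  have : 0 ≤ r * x := by positivity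
  nlinarith [mul_le_mul_of_nonneg_left hcos this, sq_nonneg (r - x)]

lemma sector_bound' (α : ℝ) (h1 : 1 < α) (h2 : α < 2) :
    ∃ c > (0:ℝ), ∀ s : ℂ, 0 < s.re → ∀ z : ℂ, 0 < z.re → |z.im| < c * z.re →
      c * (‖s‖ ^ α + z.re) ≤ ‖s ^ (α:ℂ) + z‖ := by
  obtain ⟨c, hc, h⟩ := sector_bound α h1 h2
  refine ⟨c / 2, by positivity, fun s hs z hz him => ?_⟩
  have h3 := h s hs z.re hz.le
  have h4 : s ^ (α:ℂ) + (z.re : ℂ) = (s ^ (α:ℂ) + z) - z.im * Complex.I := by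
    have := Complex.re_add_im z
    linear_combination this
  have h5 : ‖s ^ (α:ℂ) + (z.re : ℂ)‖ ≤ ‖s ^ (α:ℂ) + z‖ + |z.im| := by
    rw [h4]
    refine (norm_sub_le _ _).trans ?_
    simp
  have : 0 ≤ ‖s‖ ^ α := by positivity
  nlinarith

noncomputable def ck (α β ε : ℝ) (φ : ℝ → ℂ) (k : ℕ) : ℂ :=
  ∫ t in Set.Ioi (0:ℝ), ((t ^ (α * k + β - 1) / Real.Gamma (α * k + β) *
    Real.exp (-(ε * t)) : ℝ) : ℂ) * φ t

noncomputable def Ff (α β ε : ℝ) (z : ℂ) (ω : ℝ) : ℂ :=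
  sv ε ω ^ (-(β:ℂ)) * (sv ε ω ^ (α:ℂ) / (sv ε ω ^ (α:ℂ) + z))

lemma bound_k (ε p B : ℝ) (hε : 0 < ε) (hp : 1 ≤ p) (hB : 0 < B) (φ : ℝ → ℂ)
    (hφ : ∀ t, B < t → φ t = 0) (t : ℝ) (ht : 0 < t) :
    ‖((t ^ (p - 1) / Real.Gamma p * Real.exp (-(ε * t)) : ℝ) : ℂ) * φ t‖ ≤
      B ^ (p - 1) / Real.Gamma p * ‖φ t‖ := by
  have hG : 0 < Real.Gamma p := Real.Gamma_pos_of_pos (by linarith)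
  rw [norm_mul, Complex.norm_real, Real.norm_of_nonneg (by positivity)]
  by_cases hb : B < t
  · rw [hφ t hb]; simp
  · push Not at hb
    have : Real.exp (-(ε * t)) ≤ 1 := Real.exp_le_one_iff.2 (by nlinarith)
    calc t ^ (p - 1) / Real.Gamma p * Real.exp (-(ε * t)) * ‖φ t‖ ≤
        B ^ (p - 1) / Real.Gamma p * 1 * ‖φ t‖ := by gcongr
      _ = _ := by ring

lemma int_k (ε p B : ℝ) (hε : 0 < ε) (hp : 1 ≤ p) (hB : 0 < B) (φ : ℝ → ℂ) (hi : Integrable φ)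
    (hφ : ∀ t, B < t → φ t = 0) :
    IntegrableOn (fun t : ℝ => ((t ^ (p - 1) / Real.Gamma p * Real.exp (-(ε * t)) : ℝ) : ℂ) * φ t)
      (Set.Ioi 0) := by
  refine Integrable.mono' (g := fun t => B ^ (p - 1) / Real.Gamma p * ‖φ t‖) ?_ ?_ ?_
  · exact (hi.norm.const_mul _).integrableOn
  · refine AEStronglyMeasurable.mul ?_ hi.aestronglyMeasurable.restrict
    apply Measurable.aestronglyMeasurable
    fun_prop
  · filter_upwards [self_mem_ae_restrict measurableSet_Ioi] with t ht
    exact bound_k ε p B hε hp hB φ hφ t ht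

lemma intnorm_k (ε p B : ℝ) (hε : 0 < ε) (hp : 1 ≤ p) (hB : 0 < B) (φ : ℝ → ℂ)
    (hi : Integrable φ) (hφ : ∀ t, B < t → φ t = 0) :
    ∫ t in Set.Ioi (0:ℝ), ‖((t ^ (p - 1) / Real.Gamma p * Real.exp (-(ε * t)) : ℝ) : ℂ) * φ t‖ ≤
      B ^ (p - 1) / Real.Gamma p * ∫ t, ‖φ t‖ := by
  have hG : 0 < Real.Gamma p := Real.Gamma_pos_of_pos (by linarith)
  calc _ ≤ ∫ t in Set.Ioi (0:ℝ), B ^ (p - 1) / Real.Gamma p * ‖φ t‖ := by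
        apply setIntegral_mono_on
        · exact (int_k ε p B hε hp hB φ hi hφ).norm
        · exact (hi.norm.const_mul _).integrableOn
        · exact measurableSet_Ioi
        · intro t ht; exact bound_k ε p B hε hp hB φ hφ t ht
    _ ≤ ∫ t, B ^ (p - 1) / Real.Gamma p * ‖φ t‖ := by
        apply setIntegral_le_integral (hi.norm.const_mul _)
        exact Filter.Eventually.of_forall fun t => by simp only [Pi.zero_apply]; positivity
    _ = _ := by rw [integral_const_mul]

lemma sum_k (α β B R N : ℝ) (hα : 0 < α) (hβ : 1 ≤ β) (hB : 0 < B) (hR : 0 ≤ R) :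
    Summable fun k : ℕ => R ^ k * (B ^ (α * k + β - 1) / Real.Gamma (α * k + β) * N) := by
  have := (ml_summable α β (R * B ^ α) hα hβ).mul_right (B ^ (β - 1) * N)
  refine this.congr fun k => ?_
  rw [abs_of_nonneg (by positivity), mul_pow, ← Real.rpow_natCast (B ^ α), ← Real.rpow_mul hB.le,
    show α * k + β - 1 = α * k + (β - 1) by ring, Real.rpow_add hB]
  ring

lemma pk_ge (α β : ℝ) (hα : 0 < α) (hβ : 1 ≤ β) (k : ℕ) : 1 ≤ α * k + β := by
  have : 0 ≤ α * k := by positivity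
  linarith

lemma entire (α β ε B : ℝ) (hα : 0 < α) (hβ : 1 ≤ β) (hε : 0 < ε) (hB : 0 < B) (φ : ℝ → ℂ)
    (hi : Integrable φ) (hφ : ∀ t, B < t → φ t = 0) :
    Differentiable ℂ fun z : ℂ => ∑' k : ℕ, (-z) ^ k * ck α β ε φ k := by
  intro z
  have h := Complex.differentiableOn_tsum_of_summable_norm (F := fun (k : ℕ) (z : ℂ) => (-z) ^ k * ck α β ε φ k)
    (sum_k α β B (‖z‖ + 1) (∫ t, ‖φ t‖) hα hβ hB (by positivity))
    (U := Metric.ball 0 (‖z‖ + 1)) ?_ Metric.isOpen_ball ?_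
  · exact h.differentiableAt (Metric.isOpen_ball.mem_nhds (by simp))
  · intro k
    apply Differentiable.differentiableOn
    fun_prop
  · intro k w hw
    rw [norm_mul, norm_pow, norm_neg]
    have hw : ‖w‖ < ‖z‖ + 1 := by simpa using hw
    have := (norm_integral_le_integral_norm _).trans
      (intnorm_k ε (α * k + β) B hε (pk_ge α β hα hβ k) hB φ hi hφ)
    gcongr
    exact this

lemma pair_real (α β ε B : ℝ) (hα : 0 < α) (hβ : 1 ≤ β) (hε : 0 < ε) (hB : 0 < B) (φ : ℝ → ℂ)
    (hi : Integrable φ) (hφ : ∀ t, B < t → φ t = 0) (x : ℝ) :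
    ∫ t in Set.Ioi (0:ℝ), ((t ^ (β - 1) * (∑' k : ℕ, (-x * t ^ α) ^ k / Real.Gamma (α * k + β)) *
      Real.exp (-(ε * t)) : ℝ) : ℂ) * φ t = ∑' k : ℕ, (-(x:ℂ)) ^ k * ck α β ε φ k := by
  have h := hasSum_integral_of_summable_integral_norm (μ := volume.restrict (Set.Ioi (0:ℝ)))
    (F := fun (k : ℕ) (t : ℝ) => (-(x:ℂ)) ^ k * (((t ^ (α * k + β - 1) / Real.Gamma (α * k + β) *
    Real.exp (-(ε * t)) : ℝ) : ℂ) * φ t)) ?_ ?_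
  · have h2 := h.tsum_eq
    simp only [integral_const_mul] at h2
    unfold ck
    rw [h2]
    apply setIntegral_congr_fun measurableSet_Ioi
    intro t ht
    have ht : (0:ℝ) < t := ht
    simp only
    have e1 : ∀ k : ℕ, (-(x:ℂ)) ^ k * (((t ^ (α * k + β - 1) / Real.Gamma (α * k + β) *
        Real.exp (-(ε * t)) : ℝ) : ℂ) * φ t) =
        (((-x * t ^ α) ^ k / Real.Gamma (α * k + β) : ℝ) : ℂ) *
          ((t ^ (β - 1) * Real.exp (-(ε * t)) : ℝ) * φ t) := by
      intro k
      rw [show α * k + β - 1 = α * k + (β - 1) by ring, Real.rpow_add ht, Real.rpow_mul ht.le,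
        Real.rpow_natCast]
      push_cast
      ring
    simp_rw [e1]
    rw [tsum_mul_right, ← Complex.ofReal_tsum]
    push_cast
    ring
  · intro k
    exact (int_k ε (α * k + β) B hε (pk_ge α β hα hβ k) hB φ hi hφ).const_mul _
  · refine Summable.of_nonneg_of_le (fun k => by positivity) ?_
      (sum_k α β B |x| (∫ t, ‖φ t‖) hα hβ hB (by positivity))
    intro k
    have := intnorm_k ε (α * k + β) B hε (pk_ge α β hα hβ k) hB φ hi hφ
    have e : ∀ t : ℝ, ‖(-(x:ℂ)) ^ k * (((t ^ (α * k + β - 1) / Real.Gamma (α * k + β) *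
        Real.exp (-(ε * t)) : ℝ) : ℂ) * φ t)‖ = |x| ^ k * ‖((t ^ (α * k + β - 1) /
          Real.Gamma (α * k + β) * Real.exp (-(ε * t)) : ℝ) : ℂ) * φ t‖ := by
      intro t
      rw [norm_mul, norm_pow, norm_neg, Complex.norm_real, Real.norm_eq_abs]
    simp_rw [e]
    rw [integral_const_mul]
    gcongr

open FourierTransform in
lemma pair_small (α β ε : ℝ) (hα : 0 < α) (hβ : 1 ≤ β) (hε : 0 < ε) (φ : SchwartzMap ℝ ℂ)
    (z : ℂ) (hz : ‖z‖ < ε ^ α / 2) :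
    ∑' k : ℕ, (-z) ^ k * ck α β ε φ k = ∫ ω, Ff α β ε z ω * (𝓕⁻ φ) ω := by
  have hck : ∀ k, ck α β ε φ k = ∫ ω, sv ε ω ^ (-((α * k + β : ℝ):ℂ)) * (𝓕⁻ φ) ω := fun k =>
    pair_k ε hε (α * k + β) (by have := pk_ge α β hα hβ k; linarith) φ
  have hεα : 0 < ε ^ α := by positivity
  have hnorm : ∀ (k : ℕ) ω, ‖(-z) ^ k * (sv ε ω ^ (-((α * k + β : ℝ):ℂ)) * (𝓕⁻ φ) ω)‖ ≤
      (1/2) ^ k * (ε ^ (-β) * ‖(𝓕⁻ φ) ω‖) := by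
    intro k ω
    have hp : 0 ≤ α * k + β := by have := pk_ge α β hα hβ k; linarith
    rw [norm_mul, norm_mul, norm_pow, norm_neg, ← Complex.ofReal_neg,
      norm_cpow_ofReal _ (by rw [sv_re]; exact hε)]
    have h1 : ‖sv ε ω‖ ^ (-(α * k + β)) ≤ ε ^ (-(α * k + β)) :=
      Real.rpow_le_rpow_of_nonpos hε (sv_norm_ge ε ω hε) (by linarith)
    have h2 : ε ^ (-(α * k + β)) = ((ε ^ α) ^ k)⁻¹ * ε ^ (-β) := by
      rw [neg_add, Real.rpow_add hε, Real.rpow_neg hε.le, Real.rpow_mul hε.le, Real.rpow_natCast]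
    calc ‖z‖ ^ k * (‖sv ε ω‖ ^ (-(α * k + β)) * ‖(𝓕⁻ φ) ω‖)
        ≤ (ε ^ α / 2) ^ k * ((((ε ^ α) ^ k)⁻¹ * ε ^ (-β)) * ‖(𝓕⁻ φ) ω‖) := by
          rw [← h2]; gcongr
      _ = _ := by rw [div_pow, one_div, inv_pow]; field_simp
  have hψ := (𝓕⁻ φ).integrable (μ := volume)
  have hInt : ∀ k : ℕ, Integrable fun ω =>
      (-z) ^ k * (sv ε ω ^ (-((α * k + β : ℝ):ℂ)) * (𝓕⁻ φ) ω) := by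
    intro k
    refine Integrable.mono' ((hψ.norm.const_mul (ε ^ (-β))).const_mul ((1/2) ^ k)) ?_
      (Filter.Eventually.of_forall (hnorm k))
    apply Continuous.aestronglyMeasurable
    have := sv_cpow_continuous ε hε (-((α * k + β : ℝ):ℂ))
    have := (𝓕⁻ φ).continuous
    fun_prop
  have h := hasSum_integral_of_summable_integral_norm hInt ?_
  · have h2 := h.tsum_eq
    simp only [integral_const_mul] at h2
    simp_rw [hck]
    rw [h2]
    congr 1
    ext ω
    have hs := sv_ne ε ω hε
    have e1 : ∀ k : ℕ, (-z) ^ k * (sv ε ω ^ (-((α * k + β : ℝ):ℂ)) * (𝓕⁻ φ) ω) =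
        (-z / sv ε ω ^ (α:ℂ)) ^ k * (sv ε ω ^ (-(β:ℂ)) * (𝓕⁻ φ) ω) := by
      intro k
      have : -((α * k + β : ℝ):ℂ) = -((k:ℂ) * α) + -(β:ℂ) := by push_cast; ring
      rw [this, Complex.cpow_add _ _ hs, Complex.cpow_neg, mul_comm (k:ℂ), Complex.cpow_mul_nat,
        div_pow]
      ring
    simp_rw [e1]
    have hn : ‖sv ε ω ^ (α:ℂ)‖ = ‖sv ε ω‖ ^ α := norm_cpow_ofReal _ (by rw [sv_re]; exact hε) α
    have hge : ε ^ α ≤ ‖sv ε ω ^ (α:ℂ)‖ := by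
      rw [hn]
      have := sv_norm_ge ε ω hε
      gcongr
    have hlt : ‖-z / sv ε ω ^ (α:ℂ)‖ < 1 := by
      rw [norm_div, norm_neg, div_lt_one (by linarith)]
      linarith
    rw [tsum_mul_right, tsum_geometric_of_norm_lt_one hlt]
    have h0 : sv ε ω ^ (α:ℂ) ≠ 0 := by
      rw [← norm_pos_iff]; linarith
    have h1 : sv ε ω ^ (α:ℂ) + z ≠ 0 := by
      intro h
      have : sv ε ω ^ (α:ℂ) = -z := by linear_combination h
      rw [this, norm_neg] at hge
      linarith
    unfold Ff
    have : 1 - -z / sv ε ω ^ (α:ℂ) = (sv ε ω ^ (α:ℂ) + z) / sv ε ω ^ (α:ℂ) := by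
      field_simp; ring
    rw [this, inv_div]
    ring
  · refine Summable.of_nonneg_of_le (fun k => by positivity) (fun k => integral_mono (hInt k).norm
      ((hψ.norm.const_mul (ε ^ (-β))).const_mul ((1/2) ^ k)) (hnorm k)) ?_
    simp_rw [integral_const_mul]
    exact summable_geometric_two.mul_right _

open FourierTransform in
lemma pair_full (α β ε B : ℝ) (h1 : 1 < α) (h2 : α < 2) (hβ : 1 ≤ β) (hε : 0 < ε) (hB : 0 < B)
    (φ : SchwartzMap ℝ ℂ) (hφ : ∀ t, B < t → φ t = 0) (x : ℝ) (hx : 0 < x) :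
    ∫ t in Set.Ioi (0:ℝ), ((t ^ (β - 1) * mittagLeffler α β (-x * t ^ α) *
      Real.exp (-(ε * t)) : ℝ) : ℂ) * φ t = ∫ ω, Ff α β ε x ω * (𝓕⁻ φ) ω := by
  have hα : 0 < α := by linarith
  obtain ⟨c, hc, hsec⟩ := sector_bound' α h1 h2
  unfold mittagLeffler
  rw [pair_real α β ε B hα hβ hε hB φ φ.integrable hφ x]
  set U : Set ℂ := {z | 0 < z.re} ∩ ({z | z.im < c * z.re} ∩ {z | -(c * z.re) < z.im}) with hU
  have hUo : IsOpen U := by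
    refine (isOpen_lt continuous_const Complex.continuous_re).inter (IsOpen.inter ?_ ?_)
    · exact isOpen_lt Complex.continuous_im (by fun_prop)
    · exact isOpen_lt (by fun_prop) Complex.continuous_im
  have hUc : Convex ℝ U := by
    intro z hz w hw a b ha hb hab
    simp only [hU, Set.mem_inter_iff, Set.mem_ofPred_eq] at hz hw ⊢
    obtain ⟨hz1, hz2, hz3⟩ := hz
    obtain ⟨hw1, hw2, hw3⟩ := hw
    simp only [Complex.add_re, Complex.smul_re, Complex.add_im, Complex.smul_im, smul_eq_mul]
    rcases eq_or_lt_of_le ha with rfl | ha'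
    · have : b = 1 := by linarith
      subst this
      simp [hw1, hw2, hw3]
    · refine ⟨?_, ?_, ?_⟩ <;> nlinarith
  have hUm : ∀ z ∈ U, 0 < z.re ∧ |z.im| < c * z.re := by
    rintro z ⟨a, b, d⟩
    exact ⟨a, abs_lt.2 ⟨d, b⟩⟩
  have hreal : ∀ y : ℝ, 0 < y → (y : ℂ) ∈ U := by
    intro y hy
    have : 0 < c * y := by positivity
    simp [hU, hy, this]
  have hψ := (𝓕⁻ φ).integrable (μ := volume)
  have hlow : ∀ z ∈ U, ∀ ω, c * ‖sv ε ω‖ ^ α ≤ ‖sv ε ω ^ (α:ℂ) + z‖ := by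
    intro z hz ω
    obtain ⟨ha, hb⟩ := hUm z hz
    have := hsec (sv ε ω) (by rw [sv_re]; exact hε) z ha hb
    refine le_trans ?_ this
    gcongr
    linarith
  have hspos : ∀ ω, 0 < ‖sv ε ω‖ := fun ω => norm_pos_iff.2 (sv_ne ε ω hε)
  have hne : ∀ z ∈ U, ∀ ω, sv ε ω ^ (α:ℂ) + z ≠ 0 := by
    intro z hz ω
    rw [← norm_pos_iff]
    have := hspos ω
    refine lt_of_lt_of_le ?_ (hlow z hz ω)
    positivity
  have hJ : DifferentiableOn ℂ (fun z : ℂ => ∫ ω, Ff α β ε z ω * (𝓕⁻ φ) ω) U := by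
    intro z hz
    apply DifferentiableAt.differentiableWithinAt
    have cont1 : ∀ z ∈ U, Continuous fun ω => Ff α β ε z ω * (𝓕⁻ φ) ω := by
      intro z hz
      unfold Ff
      refine Continuous.mul (Continuous.mul (sv_cpow_continuous ε hε _) (Continuous.div ?_ ?_
        (hne z hz))) (𝓕⁻ φ).continuous
      · exact sv_cpow_continuous ε hε _
      · exact (sv_cpow_continuous ε hε _).add continuous_const
    have := hasDerivAt_integral_of_dominated_loc_of_deriv_le (μ := (volume : Measure ℝ))
      (F := fun (z : ℂ) (ω : ℝ) => Ff α β ε z ω * (𝓕⁻ φ) ω)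
      (F' := fun (z : ℂ) (ω : ℝ) => sv ε ω ^ (-(β:ℂ)) * (-(sv ε ω ^ (α:ℂ)) /
        (sv ε ω ^ (α:ℂ) + z) ^ 2) * (𝓕⁻ φ) ω)
      (x₀ := z) (s := U)
      (bound := fun ω => ε ^ (-β) * ((c ^ 2)⁻¹ * ε ^ (-α)) * ‖(𝓕⁻ φ) ω‖)
      (hUo.mem_nhds hz) ?_ ?_ ?_ ?_ ?_ ?_
    · exact this.2.differentiableAt
    · filter_upwards [hUo.mem_nhds hz] with w hw
      exact (cont1 w hw).aestronglyMeasurable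
    · refine Integrable.mono' (hψ.norm.const_mul (ε ^ (-β) * c⁻¹))
        (cont1 z hz).aestronglyMeasurable (Filter.Eventually.of_forall fun ω => ?_)
      have hs := hspos ω
      have hl := hlow z hz ω
      unfold Ff
      rw [norm_mul, norm_mul, norm_div, ← Complex.ofReal_neg,
        norm_cpow_ofReal _ (by rw [sv_re]; exact hε), norm_cpow_ofReal _ (by rw [sv_re]; exact hε)]
      have b1 : ‖sv ε ω‖ ^ (-β) ≤ ε ^ (-β) :=
        Real.rpow_le_rpow_of_nonpos hε (sv_norm_ge ε ω hε) (by linarith)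
      have b2 : ‖sv ε ω‖ ^ α / ‖sv ε ω ^ (α:ℂ) + z‖ ≤ c⁻¹ := by
        rw [div_le_iff₀ (lt_of_lt_of_le (by positivity) hl), inv_mul_eq_div, le_div_iff₀ hc]
        linarith
      gcongr
    · apply Continuous.aestronglyMeasurable
      refine Continuous.mul (Continuous.mul (sv_cpow_continuous ε hε _) (Continuous.div ?_ ?_
        fun ω => pow_ne_zero 2 (hne z hz ω))) (𝓕⁻ φ).continuous
      · exact (sv_cpow_continuous ε hε _).neg
      · exact ((sv_cpow_continuous ε hε _).add continuous_const).pow 2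
    · refine Filter.Eventually.of_forall fun ω w hw => ?_
      have hs := hspos ω
      have hl := hlow w hw ω
      rw [norm_mul, norm_mul, norm_div, norm_neg, norm_pow, ← Complex.ofReal_neg,
        norm_cpow_ofReal _ (by rw [sv_re]; exact hε), norm_cpow_ofReal _ (by rw [sv_re]; exact hε)]
      have b1 : ‖sv ε ω‖ ^ (-β) ≤ ε ^ (-β) :=
        Real.rpow_le_rpow_of_nonpos hε (sv_norm_ge ε ω hε) (by linarith)
      have b3 : ‖sv ε ω‖ ^ (-α) ≤ ε ^ (-α) :=
        Real.rpow_le_rpow_of_nonpos hε (sv_norm_ge ε ω hε) (by linarith)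
      have b2 : ‖sv ε ω‖ ^ α / ‖sv ε ω ^ (α:ℂ) + w‖ ^ 2 ≤ (c ^ 2)⁻¹ * ε ^ (-α) := by
        calc _ ≤ ‖sv ε ω‖ ^ α / (c * ‖sv ε ω‖ ^ α) ^ 2 := by gcongr
          _ = (c ^ 2)⁻¹ * ‖sv ε ω‖ ^ (-α) := by
            rw [Real.rpow_neg hs.le]; field_simp
          _ ≤ _ := by gcongr
      gcongr
    · exact hψ.norm.const_mul _
    · refine Filter.Eventually.of_forall fun ω w hw => ?_
      have hd : HasDerivAt (fun w : ℂ => sv ε ω ^ (α:ℂ) + w) 1 w := by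
        simpa using (hasDerivAt_id w).const_add (sv ε ω ^ (α:ℂ))
      have hd2 := (hasDerivAt_const w (sv ε ω ^ (α:ℂ))).div hd (hne w hw ω)
      have hd3 := (hd2.const_mul (sv ε ω ^ (-(β:ℂ)))).mul_const ((𝓕⁻ φ) ω)
      unfold Ff
      exact hd3.congr_deriv (by rw [zero_mul, zero_sub, mul_one])
  have hE := entire α β ε B hα hβ hε hB φ φ.integrable hφ
  have hεα : 0 < ε ^ α := by positivity
  have key := AnalyticOnNhd.eqOn_of_preconnected_of_eventuallyEq (z₀ := ((ε ^ α / 4 : ℝ) : ℂ))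
    (hE.differentiableOn.analyticOnNhd hUo) (hJ.analyticOnNhd hUo) hUc.isPreconnected
    (hreal _ (by positivity)) ?_
  · exact key (hreal x hx)
  · have : Metric.ball (0:ℂ) (ε ^ α / 2) ∈ nhds ((ε ^ α / 4 : ℝ) : ℂ) := by
      apply Metric.isOpen_ball.mem_nhds
      rw [mem_ball_zero_iff, Complex.norm_real, Real.norm_of_nonneg (by positivity)]
      linarith
    filter_upwards [this] with z hz
    exact pair_small α β ε hα hβ hε φ z (by simpa using hz)

lemma ml_continuous (α β : ℝ) (hα : 0 < α) (hβ : 1 ≤ β) : Continuous (mittagLeffler α β) := by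
  rw [continuous_iff_continuousAt]
  intro x
  have h : ContinuousOn (fun y => ∑' k : ℕ, y ^ k / Real.Gamma (α * k + β))
      (Metric.ball 0 (|x| + 1)) := by
    apply continuousOn_tsum (u := fun k : ℕ => |(|x| + 1)| ^ k / Real.Gamma (α * k + β))
    · intro k
      fun_prop
    · exact ml_summable α β (|x| + 1) hα hβ
    · intro k y hy
      have hy : |y| < |x| + 1 := by simpa using hy
      have hG : 0 < Real.Gamma (α * k + β) :=
        Real.Gamma_pos_of_pos (by have := pk_ge α β hα hβ k; linarith)
      rw [norm_div, norm_pow, Real.norm_eq_abs, Real.norm_of_nonneg hG.le,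
        abs_of_nonneg (by positivity : 0 ≤ |x| + 1)]
      gcongr
  exact h.continuousAt (Metric.isOpen_ball.mem_nhds (by simp))

lemma Ff_bound (α β θ : ℝ) (h1 : 1 < α) (h2 : α < 2) (hθ0 : 0 ≤ θ) (hθ1 : θ ≤ 1) :
    ∃ c > (0:ℝ), ∀ ε : ℝ, ε > 0 → ∀ x : ℝ, x > 0 → ∀ ω, ‖Ff α β ε x ω‖ ≤
      c * x ^ (-θ) * ‖sv ε ω‖ ^ (α * θ - β) := by
  obtain ⟨c, hc, hsec⟩ := sector_bound α h1 h2
  refine ⟨c⁻¹, by positivity, fun ε hε x hx ω => ?_⟩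
  have hs : 0 < ‖sv ε ω‖ := norm_pos_iff.2 (sv_ne ε ω hε)
  have h := hsec (sv ε ω) (by rw [sv_re]; exact hε) x hx.le
  have hy : (‖sv ε ω‖ ^ α) ^ (1 - θ) * x ^ θ ≤ ‖sv ε ω‖ ^ α + x := by
    have hr : 0 ≤ ‖sv ε ω‖ ^ α := by positivity
    have := Real.geom_mean_le_arith_mean2_weighted (by linarith : 0 ≤ 1 - θ) hθ0 hr hx.le (by ring)
    nlinarith
  unfold Ff
  rw [norm_mul, norm_div, ← Complex.ofReal_neg,
    norm_cpow_ofReal _ (by rw [sv_re]; exact hε), norm_cpow_ofReal _ (by rw [sv_re]; exact hε)]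
  have hden : c * ((‖sv ε ω‖ ^ α) ^ (1 - θ) * x ^ θ) ≤ ‖sv ε ω ^ (α:ℂ) + x‖ :=
    le_trans (by gcongr) h
  calc ‖sv ε ω‖ ^ (-β) * (‖sv ε ω‖ ^ α / ‖sv ε ω ^ (α:ℂ) + x‖)
      ≤ ‖sv ε ω‖ ^ (-β) * (‖sv ε ω‖ ^ α / (c * ((‖sv ε ω‖ ^ α) ^ (1 - θ) * x ^ θ))) := by
        gcongr
    _ = c⁻¹ * (x ^ θ)⁻¹ * (‖sv ε ω‖ ^ (-β) * ‖sv ε ω‖ ^ α * ((‖sv ε ω‖ ^ α) ^ (1 - θ))⁻¹) := by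
        field_simp
    _ = _ := by
        rw [← Real.rpow_mul hs.le, ← Real.rpow_neg hs.le, ← Real.rpow_neg hx.le,
          ← Real.rpow_add hs, ← Real.rpow_add hs]
        congr 2; ring

lemma sv_int (q : ℝ) (hq : q < -1) : ∃ K > (0:ℝ), ∀ ε : ℝ, ε > 0 →
    ∫⁻ ω, ENNReal.ofReal (‖sv ε ω‖ ^ q) ≤ ENNReal.ofReal (K * ε ^ (q + 1)) := by
  have hint : Integrable (fun ω : ℝ => (1 + ‖ω‖) ^ q) := by
    have := integrable_one_add_norm (E := ℝ) (μ := volume) (r := -q) (by simp; linarith)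
    simpa using this
  have hK0 : 0 ≤ ∫ ω : ℝ, (1 + ‖ω‖) ^ q := integral_nonneg fun ω => by positivity
  refine ⟨(1/2) ^ q * (∫ ω : ℝ, (1 + ‖ω‖) ^ q) + 1, by positivity, fun ε hε => ?_⟩
  have hint2 : Integrable (fun ω : ℝ => (ε / 2) ^ q * (1 + ‖ω / ε‖) ^ q) :=
    (hint.comp_div hε.ne').const_mul _
  have hle : ∀ ω, ‖sv ε ω‖ ^ q ≤ (ε / 2) ^ q * (1 + ‖ω / ε‖) ^ q := by
    intro ω
    rw [← Real.mul_rpow (by positivity) (by positivity)]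
    apply Real.rpow_le_rpow_of_nonpos (by positivity) _ (by linarith)
    have a1 := sv_norm_ge ε ω hε
    have a2 := Complex.abs_im_le_norm (sv ε ω)
    have a3 : (sv ε ω).im = 2 * Real.pi * ω := by simp [sv]
    have a4 := Real.pi_gt_three
    rw [a3, abs_mul, abs_of_pos (by positivity)] at a2
    rw [norm_div, Real.norm_eq_abs, Real.norm_of_nonneg hε.le]
    have : ε / 2 * (1 + |ω| / ε) = (ε + |ω|) / 2 := by field_simp
    rw [this]
    nlinarith [abs_nonneg ω]
  calc ∫⁻ ω, ENNReal.ofReal (‖sv ε ω‖ ^ q)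
      ≤ ∫⁻ ω, ENNReal.ofReal ((ε / 2) ^ q * (1 + ‖ω / ε‖) ^ q) :=
        lintegral_mono fun ω => ENNReal.ofReal_le_ofReal (hle ω)
    _ = ENNReal.ofReal (∫ ω, (ε / 2) ^ q * (1 + ‖ω / ε‖) ^ q) :=
        (ofReal_integral_eq_lintegral_ofReal hint2
          (Filter.Eventually.of_forall fun ω => by simp only [Pi.zero_apply]; positivity)).symm
    _ ≤ _ := by
        apply ENNReal.ofReal_le_ofReal
        rw [integral_const_mul, Measure.integral_comp_div (fun ω => (1 + ‖ω‖) ^ q),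
          abs_of_pos hε, smul_eq_mul, div_eq_mul_one_div, Real.mul_rpow (by positivity) (by positivity),
          Real.rpow_add_one hε.ne']
        have : 0 ≤ ε ^ q * ε := by positivity
        linarith

open FourierTransform in
lemma l2_eq (α β ε x : ℝ) (h1 : 1 < α) (h2 : α < 2) (hβ : 1 ≤ β) (hε : 0 < ε) (hx : 0 < x)
    (hF : MemLp (Ff α β ε x) 2 volume) :
    ∫⁻ t in Set.Ioi (0:ℝ), ENNReal.ofReal ((t ^ (β - 1) * mittagLeffler α β (-x * t ^ α) *
      Real.exp (-(ε * t))) ^ 2) ≤ ∫⁻ ω, ENNReal.ofReal (‖Ff α β ε x ω‖ ^ 2) := by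
  have hα : 0 < α := by linarith
  set u : ℝ → ℂ := fun t => ((t ^ (β - 1) * mittagLeffler α β (-x * t ^ α) *
      Real.exp (-(ε * t)) : ℝ) : ℂ) with hu
  have huc : Continuous u := by
    have c1 : Continuous fun t : ℝ => t ^ (β - 1) := Real.continuous_rpow_const (by linarith)
    have c2 : Continuous fun t : ℝ => t ^ α := Real.continuous_rpow_const hα.le
    have c3 : Continuous fun t : ℝ => mittagLeffler α β (-x * t ^ α) :=
      (ml_continuous α β hα hβ).comp (continuous_const.mul c2)
    exact Complex.continuous_ofReal.comp ((c1.mul c3).mul (by fun_prop))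
  set H : Lp ℂ 2 (volume : Measure ℝ) := 𝓕⁻ (hF.toLp) with hH
  have hnorm : ‖H‖ = ‖hF.toLp‖ := by
    rw [← Lp.norm_fourier_eq H, hH, fourier_fourierInv_eq]
  have hfl : LocallyIntegrable ((Set.Ioi (0:ℝ)).indicator u) volume :=
    huc.locallyIntegrable.indicator measurableSet_Ioi
  have hHl : LocallyIntegrable (H : ℝ → ℂ) volume :=
    (Lp.memLp H).locallyIntegrable (by norm_num)
  have hae : ∀ᵐ t, (Set.Ioi (0:ℝ)).indicator u t = H t := by
    refine ae_eq_of_integral_contDiff_smul_eq hfl hHl fun g hg hgs => ?_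
    have hgs' : HasCompactSupport (fun t => (g t : ℂ)) := hgs.comp_left (g := fun y : ℝ => (y : ℂ)) rfl
    set φ : SchwartzMap ℝ ℂ := hgs'.toSchwartzMap (Complex.ofRealCLM.contDiff.comp hg) with hφ
    have hφg : ∀ t, φ t = (g t : ℂ) := fun t => rfl
    obtain ⟨B, hB0, hB⟩ : ∃ B : ℝ, 0 < B ∧ ∀ t, B < t → φ t = 0 := by
      obtain ⟨R, hR⟩ := hgs.isCompact.isBounded.subset_closedBall 0
      refine ⟨max R 1, by positivity, fun t ht => ?_⟩
      rw [hφg]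
      have : t ∉ tsupport g := by
        intro hm
        have := hR hm
        rw [mem_closedBall_zero_iff, Real.norm_eq_abs] at this
        have := le_max_left R 1
        have := le_abs_self t
        linarith
      rw [image_eq_zero_of_notMem_tsupport this]; simp
    have key := pair_full α β ε B h1 h2 hβ hε hB0 φ hB x hx
    have e1 : ∫ t, g t • (Set.Ioi (0:ℝ)).indicator u t = ∫ t in Set.Ioi (0:ℝ), u t * φ t := by
      rw [← integral_indicator measurableSet_Ioi]
      congr 1
      ext t
      by_cases ht : t ∈ Set.Ioi (0:ℝ)
      · simp only [Set.indicator_of_mem ht, hφg, Complex.real_smul]; ring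
      · simp only [Set.indicator_of_notMem ht, smul_zero]
    have e2 : ∫ t, g t • H t = ∫ ω, Ff α β ε x ω * (𝓕⁻ φ) ω := by
      have h3 := congrArg (fun T => T φ) (Lp.fourierInv_toTemperedDistribution_eq hF.toLp)
      simp only [TemperedDistribution.fourierInv_apply, Lp.toTemperedDistribution_apply] at h3
      have e3 : ∫ t, g t • H t = ∫ t, φ t • H t := by
        congr 1
      rw [e3, hH, ← h3]
      apply integral_congr_ae
      filter_upwards [hF.coeFn_toLp] with ω hω
      rw [hω, smul_eq_mul, mul_comm]
    rw [e1, e2, ← key]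
  have hL : ∀ (f : ℝ → ℂ), ∫⁻ t, ENNReal.ofReal (‖f t‖ ^ 2) = eLpNorm f 2 volume ^ 2 := by
    intro f
    rw [eLpNorm_eq_lintegral_rpow_enorm_toReal (by norm_num) (by norm_num)]
    rw [← ENNReal.rpow_natCast, ← ENNReal.rpow_mul]
    simp
  have e4 : ∫⁻ t in Set.Ioi (0:ℝ), ENNReal.ofReal ((t ^ (β - 1) * mittagLeffler α β (-x * t ^ α) *
      Real.exp (-(ε * t))) ^ 2) = ∫⁻ t, ENNReal.ofReal (‖(Set.Ioi (0:ℝ)).indicator u t‖ ^ 2) := by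
    rw [← lintegral_indicator measurableSet_Ioi]
    congr 1
    ext t
    by_cases ht : t ∈ Set.Ioi (0:ℝ)
    · simp only [Set.indicator_of_mem ht, hu, Complex.norm_real, Real.norm_eq_abs, sq_abs]
    · simp only [Set.indicator_of_notMem ht]; simp
  rw [e4, hL, hL, eLpNorm_congr_ae hae]
  have e5 : eLpNorm H 2 volume = eLpNorm (Ff α β ε x) 2 volume := by
    rw [← Lp.enorm_def, ← eLpNorm_congr_ae hF.coeFn_toLp, ← Lp.enorm_def, ← ofReal_norm,
      ← ofReal_norm, hnorm]
  rw [e5]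

lemma l2_bound (α β θ : ℝ) (h1 : 1 < α) (h2 : α < 2) (hβ : 1 ≤ β) (hθ0 : 0 ≤ θ) (hθ1 : θ ≤ 1)
    (hq : 2 * (α * θ - β) < -1) :
    ∃ C > (0:ℝ), ∀ T : ℝ, 0 < T → ∀ x : ℝ, 0 < x →
      ∫⁻ t in Set.Ioo (0:ℝ) T, ENNReal.ofReal ((t ^ (β - 1) *
        mittagLeffler α β (-x * t ^ α)) ^ 2) ≤
      ENNReal.ofReal (C * x ^ (-(2 * θ)) * T ^ (2 * β - 2 * (α * θ) - 1)) := by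
  obtain ⟨c, hc, hFb⟩ := Ff_bound α β θ h1 h2 hθ0 hθ1
  obtain ⟨K, hK, hsv⟩ := sv_int (2 * (α * θ - β)) hq
  have hα : 0 < α := by linarith
  refine ⟨Real.exp 2 * (c ^ 2 * K), by positivity, fun T hT x hx => ?_⟩
  set ε := 1 / T with hεd
  have hε : 0 < ε := by positivity
  have hsq : ∫⁻ ω, ENNReal.ofReal (‖Ff α β ε x ω‖ ^ 2) ≤
      ENNReal.ofReal (c ^ 2 * x ^ (-(2 * θ)) * (K * ε ^ (2 * (α * θ - β) + 1))) := by
    calc _ ≤ ∫⁻ ω, ENNReal.ofReal (c ^ 2 * x ^ (-(2 * θ))) *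
          ENNReal.ofReal (‖sv ε ω‖ ^ (2 * (α * θ - β))) := by
          apply lintegral_mono
          intro ω
          simp only
          rw [← ENNReal.ofReal_mul (by positivity)]
          apply ENNReal.ofReal_le_ofReal
          have := hFb ε hε x hx ω
          calc ‖Ff α β ε x ω‖ ^ 2 ≤ (c * x ^ (-θ) * ‖sv ε ω‖ ^ (α * θ - β)) ^ 2 := by gcongr
            _ = _ := by
              rw [mul_pow, mul_pow, ← Real.rpow_mul_natCast hx.le,
                ← Real.rpow_mul_natCast (norm_nonneg _)]
              push_cast
              ring_nf
      _ = ENNReal.ofReal (c ^ 2 * x ^ (-(2 * θ))) *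
          ∫⁻ ω, ENNReal.ofReal (‖sv ε ω‖ ^ (2 * (α * θ - β))) :=
          lintegral_const_mul' _ _ ENNReal.ofReal_ne_top
      _ ≤ _ := (mul_le_mul' le_rfl (hsv ε hε)).trans_eq
          (ENNReal.ofReal_mul (by positivity)).symm
  have hcont : Continuous (Ff α β ε x) := by
    unfold Ff
    refine Continuous.mul (sv_cpow_continuous ε hε _) (Continuous.div (sv_cpow_continuous ε hε _)
      ((sv_cpow_continuous ε hε _).add continuous_const) fun ω => ?_)
    obtain ⟨c', hc', hs⟩ := sector_bound α h1 h2
    rw [← norm_pos_iff]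
    refine lt_of_lt_of_le ?_ (hs (sv ε ω) (by rw [sv_re]; exact hε) x hx.le)
    positivity
  have hF : MemLp (Ff α β ε x) 2 volume := by
    rw [memLp_two_iff_integrable_sq_norm hcont.aestronglyMeasurable]
    refine ⟨(hcont.norm.pow 2).aestronglyMeasurable, ?_⟩
    rw [hasFiniteIntegral_iff_ofReal (Filter.Eventually.of_forall fun ω => by
      simp only [Pi.zero_apply]; positivity)]
    exact lt_of_le_of_lt hsq ENNReal.ofReal_lt_top
  have hmain := (l2_eq α β ε x h1 h2 hβ hε hx hF).trans hsq
  calc _ ≤ ∫⁻ t in Set.Ioo (0:ℝ) T, ENNReal.ofReal (Real.exp 2) * ENNReal.ofReal ((t ^ (β - 1) *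
        mittagLeffler α β (-x * t ^ α) * Real.exp (-(ε * t))) ^ 2) := by
        apply setLIntegral_mono' measurableSet_Ioo
        intro t ht
        rw [← ENNReal.ofReal_mul (by positivity)]
        apply ENNReal.ofReal_le_ofReal
        rw [mul_pow _ (Real.exp _), ← Real.exp_nat_mul]
        have : 1 ≤ Real.exp 2 * Real.exp ((2:ℕ) * -(ε * t)) := by
          rw [← Real.exp_add]
          apply Real.one_le_exp
          have : ε * t ≤ 1 := by
            rw [hεd, one_div, inv_mul_le_iff₀ hT]; linarith [ht.2]
          push_cast
          linarith
        nlinarith [sq_nonneg (t ^ (β - 1) * mittagLeffler α β (-x * t ^ α))]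
    _ = ENNReal.ofReal (Real.exp 2) * ∫⁻ t in Set.Ioo (0:ℝ) T, ENNReal.ofReal ((t ^ (β - 1) *
        mittagLeffler α β (-x * t ^ α) * Real.exp (-(ε * t))) ^ 2) :=
        lintegral_const_mul' _ _ ENNReal.ofReal_ne_top
    _ ≤ ENNReal.ofReal (Real.exp 2) *
        ENNReal.ofReal (c ^ 2 * x ^ (-(2 * θ)) * (K * ε ^ (2 * (α * θ - β) + 1))) := by
        gcongr
        exact (lintegral_mono_set Set.Ioo_subset_Ioi_self).trans hmain
    _ = _ := by
        rw [← ENNReal.ofReal_mul (by positivity)]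
        congr 1
        rw [hεd, one_div, Real.inv_rpow hT.le, ← Real.rpow_neg hT.le]
        ring_nf

/-- For `α ∈ (1,2)` there is `C > 0` depending only on `α` such that for all `T > 0`,
all positive `λ_n` and all real `a_n, b_n` (sums and integral taken in `[0,∞]`):
`∫_0^T ∑ λ_n² |a_n E_α(-λ_n t^α) + b_n t E_{α,2}(-λ_n t^α)|² dt
  ≤ C T^{1-α/2} ∑ λ_n^{3/2} a_n² + C T^{3-(3/2)α} ∑ λ_n^{1/2} b_n²`.
This is the bound `‖∂_t^α u‖²_{L²(0,T;L²)} ≤ C T^{1-α/2}‖∇Δu_0‖² + C T^{3-3α/2}‖∇u_1‖²`. -/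
theorem petrovsky_caputo_L2_bound (α : ℝ) (hα₁ : 1 < α) (hα₂ : α < 2) :
    ∃ C > (0 : ℝ), ∀ T : ℝ, 0 < T → ∀ lam a b : ℕ → ℝ, (∀ n, 0 < lam n) →
      (∫⁻ t in Set.Ioo (0 : ℝ) T,
          ∑' n, ENNReal.ofReal ((lam n) ^ (2 : ℝ) *
            (a n * mittagLeffler α 1 (-(lam n) * t ^ α) +
              b n * t * mittagLeffler α 2 (-(lam n) * t ^ α)) ^ 2)) ≤
        ENNReal.ofReal (C * T ^ (1 - α / 2)) *
            (∑' n, ENNReal.ofReal ((lam n) ^ ((3 : ℝ) / 2) * (a n) ^ 2)) +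
          ENNReal.ofReal (C * T ^ (3 - 3 * α / 2)) *
            (∑' n, ENNReal.ofReal ((lam n) ^ ((1 : ℝ) / 2) * (b n) ^ 2)) := by
  obtain ⟨C1, hC1, H1⟩ := l2_bound α 1 (1/4) hα₁ hα₂ le_rfl (by norm_num) (by norm_num) (by linarith)
  obtain ⟨C2, hC2, H2⟩ := l2_bound α 2 (3/4) hα₁ hα₂ (by norm_num) (by norm_num) (by norm_num)
    (by linarith)
  have hα : 0 < α := by linarith
  refine ⟨2 * (C1 + C2), by positivity, fun T hT lam a b hlam => ?_⟩
  have hc2 : Continuous fun t : ℝ => t ^ α := Real.continuous_rpow_const hα.le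
  have hm1 : ∀ n, Continuous fun t : ℝ => mittagLeffler α 1 (-(lam n) * t ^ α) := fun n =>
    (ml_continuous α 1 hα le_rfl).comp (continuous_const.mul hc2)
  have hm2 : ∀ n, Continuous fun t : ℝ => mittagLeffler α 2 (-(lam n) * t ^ α) := fun n =>
    (ml_continuous α 2 hα (by norm_num)).comp (continuous_const.mul hc2)
  rw [lintegral_tsum]
  swap
  · intro n
    have := hm1 n
    have := hm2 n
    apply Measurable.aemeasurable
    apply Measurable.ennreal_ofReal
    apply Continuous.measurable
    fun_prop
  rw [← ENNReal.tsum_mul_left, ← ENNReal.tsum_mul_left, ← ENNReal.tsum_add]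
  apply ENNReal.tsum_le_tsum
  intro n
  have hl := hlam n
  calc _ ≤ ∫⁻ t in Set.Ioo (0 : ℝ) T,
        (ENNReal.ofReal (2 * lam n ^ (2:ℝ) * a n ^ 2) *
          ENNReal.ofReal ((t ^ ((1:ℝ) - 1) * mittagLeffler α 1 (-(lam n) * t ^ α)) ^ 2) +
        ENNReal.ofReal (2 * lam n ^ (2:ℝ) * b n ^ 2) *
          ENNReal.ofReal ((t ^ ((2:ℝ) - 1) * mittagLeffler α 2 (-(lam n) * t ^ α)) ^ 2)) := by
        apply lintegral_mono
        intro t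
        simp only
        rw [← ENNReal.ofReal_mul (by positivity), ← ENNReal.ofReal_mul (by positivity),
          ← ENNReal.ofReal_add (by positivity) (by positivity)]
        apply ENNReal.ofReal_le_ofReal
        rw [show (2:ℝ) - 1 = 1 by norm_num, Real.rpow_one, sub_self, Real.rpow_zero]
        have h0 : 0 ≤ lam n ^ (2:ℝ) := by positivity
        nlinarith [mul_nonneg h0 (sq_nonneg (a n * mittagLeffler α 1 (-(lam n) * t ^ α) -
          b n * t * mittagLeffler α 2 (-(lam n) * t ^ α)))]
    _ = ENNReal.ofReal (2 * lam n ^ (2:ℝ) * a n ^ 2) * (∫⁻ t in Set.Ioo (0 : ℝ) T,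
          ENNReal.ofReal ((t ^ ((1:ℝ) - 1) * mittagLeffler α 1 (-(lam n) * t ^ α)) ^ 2)) +
        ENNReal.ofReal (2 * lam n ^ (2:ℝ) * b n ^ 2) * (∫⁻ t in Set.Ioo (0 : ℝ) T,
          ENNReal.ofReal ((t ^ ((2:ℝ) - 1) * mittagLeffler α 2 (-(lam n) * t ^ α)) ^ 2)) := by
        rw [lintegral_add_left, lintegral_const_mul' _ _ ENNReal.ofReal_ne_top,
          lintegral_const_mul' _ _ ENNReal.ofReal_ne_top]
        have := (hm1 n).measurable
        fun_prop
    _ ≤ ENNReal.ofReal (2 * lam n ^ (2:ℝ) * a n ^ 2) * ENNReal.ofReal (C1 * lam n ^ (-(2 * (1/4:ℝ))) *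
          T ^ (2 * 1 - 2 * (α * (1/4)) - 1)) +
        ENNReal.ofReal (2 * lam n ^ (2:ℝ) * b n ^ 2) * ENNReal.ofReal (C2 * lam n ^ (-(2 * (3/4:ℝ))) *
          T ^ (2 * 2 - 2 * (α * (3/4)) - 1)) := by
        gcongr
        · exact H1 T hT _ hl
        · exact H2 T hT _ hl
    _ ≤ _ := by
        rw [← ENNReal.ofReal_mul (by positivity), ← ENNReal.ofReal_mul (by positivity),
          ← ENNReal.ofReal_mul (by positivity), ← ENNReal.ofReal_mul (by positivity)]
        have e1 : lam n ^ ((3:ℝ)/2) = lam n ^ (2:ℝ) * lam n ^ (-(2 * (1/4:ℝ))) := by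
          rw [← Real.rpow_add hl]; norm_num
        have e2 : lam n ^ ((1:ℝ)/2) = lam n ^ (2:ℝ) * lam n ^ (-(2 * (3/4:ℝ))) := by
          rw [← Real.rpow_add hl]; norm_num
        have e3 : 2 * 1 - 2 * (α * (1/4)) - 1 = 1 - α / 2 := by ring
        have e4 : 2 * 2 - 2 * (α * (3/4)) - 1 = 3 - 3 * α / 2 := by ring
        rw [e1, e2, e3, e4]
        gcongr ENNReal.ofReal ?_ + ENNReal.ofReal ?_
        · have : 0 ≤ lam n ^ (2:ℝ) * lam n ^ (-(2 * (1/4:ℝ))) * a n ^ 2 * T ^ (1 - α / 2) := by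
            positivity
          nlinarith [mul_nonneg this hC2.le]
        · have : 0 ≤ lam n ^ (2:ℝ) * lam n ^ (-(2 * (3/4:ℝ))) * b n ^ 2 * T ^ (3 - 3 * α / 2) := by
            positivity
          nlinarith [mul_nonneg this hC1.le]
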